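/- arXiv:0908.3121 — 2 statements merged into one kernel-verified Lean document; each statement's English description precedes it below -/
import Mathlib

section
/- Let k ≥ 0 and r ≥ 1 be integers and let Z₁, …, Zₙ be i.i.d. real random variables with law P such that E[|Z₁|^{(k+1)·max(2,r)}] < ∞. Let φ(t) = E[(iZ₁)^k e^{itZ₁}] and φ̂^{(k)}(t) = n^{−1}∑_{j=1}^{n}(iZ_j)^k e^{itZ_j}. Then there exists a constant C depending only on k and r such that for all n ≥ 1 and all 0 < h ≤ 1, E[ ( sup_{t ∈ [−1/h, 1/h]} |φ̂^{(k)}(t) − φ(t)| )^r ] ≤ C · ( (E[|Z₁|^{(k+1)·max(2,r)}])^{r/max(2,r)} + (E[|Z₁|^{k·max(2,r)}])^{r/max(2,r)} ) · h^{−r} n^{−r/2}. -/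
open MeasureTheory Complex ProbabilityTheory

lemma pow_abs_le_one_add {m q : ℕ} (hmq : m ≤ q) (x : ℝ) : |x| ^ m ≤ 1 + |x| ^ q := by
  rcases le_total |x| 1 with h | h
  · have := pow_le_one₀ (n := m) (abs_nonneg x) h
    have := pow_nonneg (abs_nonneg x) q
    linarith
  · have := pow_le_pow_right₀ h hmq
    linarith

lemma integrable_pow_abs_of_le {Ω : Type*} [MeasurableSpace Ω] {μ : Measure Ω}
    [IsFiniteMeasure μ] {f : Ω → ℝ} (hf : AEStronglyMeasurable f μ) {m q : ℕ} (hmq : m ≤ q)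
    (hq : Integrable (fun ω => |f ω| ^ q) μ) : Integrable (fun ω => |f ω| ^ m) μ := by
  refine ((integrable_const (1 : ℝ)).add hq).mono' ?_ (ae_of_all _ fun ω => ?_)
  · have : AEStronglyMeasurable (fun ω => ‖f ω‖ ^ m) μ := hf.norm.pow m
    simpa using this
  · rw [Real.norm_of_nonneg (by positivity)]
    exact pow_abs_le_one_add hmq (f ω)

/-- Lyapunov's inequality for natural exponents. -/
lemma integral_pow_abs_le {Ω : Type*} [MeasurableSpace Ω] {μ : Measure Ω}
    [IsProbabilityMeasure μ] {f : Ω → ℝ} (hf : AEStronglyMeasurable f μ) {m q : ℕ} (hmq : m ≤ q)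
    (hq : Integrable (fun ω => |f ω| ^ q) μ) :
    ∫ ω, |f ω| ^ m ∂μ ≤ (∫ ω, |f ω| ^ q ∂μ) ^ ((m : ℝ) / q) := by
  rcases Nat.eq_zero_or_pos m with rfl | hm
  · simp
  have hm0 : (0 : ℝ) < m := by exact_mod_cast hm
  have hq0 : (0 : ℝ) < q := by exact_mod_cast hm.trans_le hmq
  have hpow : ∀ ω, (|f ω| ^ m) ^ ((q : ℝ) / m) = |f ω| ^ q := fun ω => by
    rw [← Real.rpow_natCast, ← Real.rpow_mul (abs_nonneg _), mul_div_cancel₀ _ hm0.ne',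
      Real.rpow_natCast]
  have hone : (1 : ℝ) ≤ (q : ℝ) / m := by
    rw [le_div_iff₀ hm0, one_mul]; exact_mod_cast hmq
  have key := (convexOn_rpow hone).map_integral_le (μ := μ) (f := fun ω => |f ω| ^ m)
    (Real.continuous_rpow_const (by positivity)).continuousOn isClosed_Ici
    (ae_of_all _ fun ω => by simp only [Set.mem_Ici]; positivity)
    (integrable_pow_abs_of_le hf hmq hq) (by simpa only [Function.comp_def, hpow] using hq)
  simp only [hpow] at key
  have h0 : 0 ≤ ∫ ω, |f ω| ^ m ∂μ := integral_nonneg fun ω => by positivity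
  calc ∫ ω, |f ω| ^ m ∂μ = ((∫ ω, |f ω| ^ m ∂μ) ^ ((q : ℝ) / m)) ^ ((m : ℝ) / q) := by
        rw [← Real.rpow_mul h0, div_mul_div_cancel₀ hm0.ne', div_self hq0.ne', Real.rpow_one]
    _ ≤ _ := by gcongr

lemma add_pow_le_taylor (p : ℕ) : ∃ c : ℝ, 0 ≤ c ∧ ∀ x y : ℝ, 0 ≤ x → |y| ≤ x →
    (x + y) ^ (p + 2) ≤ x ^ (p + 2) + (p + 2) * (x ^ (p + 1) * y) + c * (x ^ p * y ^ 2) := by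
  induction p with
  | zero => exact ⟨1, zero_le_one, fun x y _ _ => by simp; nlinarith⟩
  | succ p ih =>
    obtain ⟨c, hc, ih⟩ := ih
    refine ⟨p + 2 + 2 * c, by positivity, fun x y hx hy => ?_⟩
    have hxy : 0 ≤ x + y := by linarith [neg_le_of_abs_le hy]
    have hxy' : x + y ≤ 2 * x := by linarith [le_of_abs_le hy]
    have h1 := mul_le_mul_of_nonneg_right (ih x y hx hy) hxy
    have h2 := mul_le_mul_of_nonneg_left hxy' (show 0 ≤ c * (x ^ p * y ^ 2) by positivity)
    push_cast
    calc (x + y) ^ (p + 1 + 2) = (x + y) ^ (p + 2) * (x + y) := by ring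
      _ ≤ _ := h1
      _ ≤ _ := by ring_nf at h2 ⊢; linarith

/-- Second-order expansion of `|x + y| ^ (p + 2)` in `y`. -/
lemma abs_add_pow_le_taylor (p : ℕ) : ∃ c : ℝ, 0 ≤ c ∧ ∀ x y : ℝ,
    |x + y| ^ (p + 2) ≤ |x| ^ (p + 2) + (p + 2) * (|x| ^ p * x * y)
      + c * (|x| ^ p * y ^ 2 + |y| ^ (p + 2)) := by
  obtain ⟨c, hc, h⟩ := add_pow_le_taylor p
  refine ⟨c + 2 ^ (p + 2) + (p + 2), by positivity, fun x y => ?_⟩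
  wlog hx : 0 ≤ x generalizing x y
  · have := this (-x) (-y) (by linarith)
    rw [← neg_add, abs_neg, abs_neg, abs_neg] at this
    simpa using this
  rcases le_or_gt |y| |x| with hyx | hyx
  · have hy : |y| ≤ x := by rwa [abs_of_nonneg hx] at hyx
    have h1 := h x y hx hy
    have hxy : 0 ≤ x + y := by linarith [neg_le_of_abs_le hy]
    rw [abs_of_nonneg hxy, abs_of_nonneg hx]
    have h2 : 0 ≤ (2 ^ (p + 2) + ((p : ℝ) + 2)) * (x ^ p * y ^ 2) := by positivity
    have h3 : 0 ≤ (c + 2 ^ (p + 2) + ((p : ℝ) + 2)) * |y| ^ (p + 2) := by positivity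
    have h4 : x ^ p * x * y = x ^ (p + 1) * y := by ring
    rw [h4]
    linarith
  · have h1 : |x + y| ^ (p + 2) ≤ 2 ^ (p + 2) * |y| ^ (p + 2) := by
      rw [← mul_pow]
      gcongr
      linarith [abs_add_le x y]
    have h2 : |(|x| ^ p * x * y)| ≤ |y| ^ (p + 2) := by
      rw [abs_mul, abs_mul, abs_of_nonneg (show 0 ≤ |x| ^ p by positivity), pow_succ, pow_succ]
      gcongr
    have h3 := neg_le_of_abs_le h2
    have h4 : 0 ≤ (c + 2 ^ (p + 2) + ((p : ℝ) + 2)) * (|x| ^ p * y ^ 2) := by positivity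
    have h5 : 0 ≤ c * |y| ^ (p + 2) := by positivity
    have h6 : 0 ≤ |x| ^ (p + 2) := by positivity
    have h7 := mul_le_mul_of_nonneg_left h3 (show (0 : ℝ) ≤ p + 2 by positivity)
    linarith

/-- The `p`-th absolute moment of a sum of independent centred variables is controlled by the
square root of the number of summands. -/
def SumMomentBound (p : ℕ) : Prop :=
  ∃ C : ℝ, 0 ≤ C ∧ ∀ (Ω : Type) [MeasurableSpace Ω] (μ : Measure Ω) [IsProbabilityMeasure μ]
    (ι : Type) (X : ι → Ω → ℝ) (σ : ℝ), 0 ≤ σ → (∀ i, Measurable (X i)) → iIndepFun X μ →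
    (∀ i, ∫ ω, X i ω ∂μ = 0) → (∀ i, Integrable (fun ω => |X i ω| ^ (max 2 p)) μ) →
    (∀ i, ∀ m ≤ max 2 p, ∫ ω, |X i ω| ^ m ∂μ ≤ σ ^ m) →
    ∀ s : Finset ι, Integrable (fun ω => |∑ i ∈ s, X i ω| ^ p) μ ∧
      ∫ ω, |∑ i ∈ s, X i ω| ^ p ∂μ ≤ C * (√(s.card) * σ) ^ p

lemma sumMomentBound_zero : SumMomentBound 0 :=
  ⟨1, zero_le_one, fun Ω _ μ _ ι X σ _ _ _ _ _ _ s => by simp⟩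

lemma SumMomentBound.add_two {p : ℕ} (hp : SumMomentBound p) : SumMomentBound (p + 2) := by
  classical
  obtain ⟨C, hC, hp⟩ := hp
  obtain ⟨K, hK, taylor⟩ := abs_add_pow_le_taylor p
  refine ⟨K * (C + 1), by positivity, fun Ω _ μ _ ι X σ hσ hX hind hmean hint hmom s => ?_⟩
  have hmax : max 2 (p + 2) = p + 2 := by simp
  rw [hmax] at hmom
  simp only [hmax] at hint
  have hle : max 2 p ≤ p + 2 := by omega
  have hpoly := hp Ω μ ι X σ hσ hX hind hmean
    (fun i => integrable_pow_abs_of_le (hX i).aestronglyMeasurable hle (hint i))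
    (fun i m hm => hmom i m (hm.trans hle))
  induction s using Finset.induction_on with
  | empty => simp
  | insert i s hi ih =>
    obtain ⟨ihint, ih⟩ := ih
    obtain ⟨hSint, hS⟩ := hpoly s
    set S : Ω → ℝ := fun ω => ∑ j ∈ s, X j ω
    have hSm : Measurable S := Finset.measurable_sum _ fun j _ => hX j
    have hSX : IndepFun S (X i) μ := by
      have := hind.indepFun_finsetSum_of_notMem hX hi
      convert this using 1
      ext ω
      simp [S]
    have hsplit : ∀ ω, ∑ j ∈ insert i s, X j ω = S ω + X i ω := fun ω => by
      rw [Finset.sum_insert hi, add_comm]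
    simp only [hsplit]
    have i1 : Integrable (fun ω => |S ω| ^ p * S ω) μ := by
      have := integrable_pow_abs_of_le hSm.aestronglyMeasurable (show p + 1 ≤ p + 2 by omega) ihint
      refine this.mono' (by fun_prop) (ae_of_all _ fun ω => ?_)
      simp [pow_succ]
    have j1 : Integrable (X i) μ := by
      have := integrable_pow_abs_of_le (hX i).aestronglyMeasurable
        (show 1 ≤ p + 2 by omega) (hint i)
      exact this.mono' (hX i).aestronglyMeasurable (ae_of_all _ fun ω => by simp)
    have j2 : Integrable (fun ω => X i ω ^ 2) μ := by
      simpa using integrable_pow_abs_of_le (hX i).aestronglyMeasurable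
        (show 2 ≤ p + 2 by omega) (hint i)
    have ind1 : IndepFun (fun ω => |S ω| ^ p * S ω) (X i) μ :=
      hSX.comp (φ := fun x => |x| ^ p * x) (ψ := id) (by fun_prop) measurable_id
    have ind2 : IndepFun (fun ω => |S ω| ^ p) (fun ω => X i ω ^ 2) μ :=
      hSX.comp (φ := fun x => |x| ^ p) (ψ := fun x => x ^ 2) (by fun_prop) (by fun_prop)
    have k1 : Integrable (fun ω => |S ω| ^ p * S ω * X i ω) μ := ind1.integrable_mul i1 j1
    have k2 : Integrable (fun ω => |S ω| ^ p * X i ω ^ 2) μ := ind2.integrable_mul hSint j2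
    have e1 : ∫ ω, |S ω| ^ p * S ω * X i ω ∂μ = 0 := by
      have := ind1.integral_fun_mul_eq_mul_integral i1.aestronglyMeasurable j1.aestronglyMeasurable
      rw [this, hmean i, mul_zero]
    have e2 : ∫ ω, |S ω| ^ p * X i ω ^ 2 ∂μ ≤ C * (√(s.card) * σ) ^ p * σ ^ 2 := by
      have := ind2.integral_fun_mul_eq_mul_integral hSint.aestronglyMeasurable
        j2.aestronglyMeasurable
      rw [this]
      have h2 := hmom i 2 (by omega)
      simp only [sq_abs] at h2
      gcongr
    have e3 := hmom i (p + 2) le_rfl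
    have r1 := k1.const_mul ((p : ℝ) + 2)
    have r2 : Integrable (fun ω => K * (|S ω| ^ p * X i ω ^ 2 + |X i ω| ^ (p + 2))) μ :=
      (k2.add (hint i)).const_mul K
    have r3 : Integrable (fun ω => |S ω| ^ (p + 2) + (p + 2) * (|S ω| ^ p * S ω * X i ω)) μ :=
      ihint.add r1
    have hdom : Integrable (fun ω => |S ω| ^ (p + 2) + (p + 2) * (|S ω| ^ p * S ω * X i ω)
        + K * (|S ω| ^ p * X i ω ^ 2 + |X i ω| ^ (p + 2))) μ := r3.add r2
    have hm : Measurable (fun ω => |S ω + X i ω| ^ (p + 2)) := by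
      have := hX i
      fun_prop
    have hL : Integrable (fun ω => |S ω + X i ω| ^ (p + 2)) μ := by
      refine hdom.mono' hm.aestronglyMeasurable (ae_of_all _ fun ω => ?_)
      rw [Real.norm_of_nonneg (by positivity)]
      exact taylor _ _
    refine ⟨hL, ?_⟩
    have hmono := integral_mono hL hdom fun ω => taylor (S ω) (X i ω)
    have hR : ∫ ω, (|S ω| ^ (p + 2) + (p + 2) * (|S ω| ^ p * S ω * X i ω)
        + K * (|S ω| ^ p * X i ω ^ 2 + |X i ω| ^ (p + 2))) ∂μ
        = ∫ ω, |S ω| ^ (p + 2) ∂μ + (p + 2) * ∫ ω, |S ω| ^ p * S ω * X i ω ∂μ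
          + K * (∫ ω, |S ω| ^ p * X i ω ^ 2 ∂μ + ∫ ω, |X i ω| ^ (p + 2) ∂μ) := by
      rw [integral_add r3 r2, integral_add ihint r1, integral_const_mul,
        integral_const_mul, integral_add k2 (hint i)]
    rw [hR, e1, mul_zero, add_zero] at hmono
    refine hmono.trans ?_
    rw [Finset.card_insert_of_notMem hi]
    push_cast
    set N : ℝ := (s.card : ℝ)
    have hN : 0 ≤ N := Nat.cast_nonneg _
    have hN1 : √N ^ p ≤ √(N + 1) ^ p := by gcongr; linarith
    have hN2 : 1 ≤ √(N + 1) ^ p := one_le_pow₀ (by rw [Real.one_le_sqrt]; linarith)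
    have hsq : ∀ x : ℝ, 0 ≤ x → (√x * σ) ^ (p + 2) = x * √x ^ p * σ ^ (p + 2) := fun x hx => by
      rw [mul_pow, pow_add, Real.sq_sqrt hx]; ring
    rw [hsq _ hN] at ih
    rw [hsq _ (by linarith)]
    calc _ ≤ K * (C + 1) * (N * √N ^ p * σ ^ (p + 2))
          + K * (C * (√N * σ) ^ p * σ ^ 2 + σ ^ (p + 2)) := by gcongr
      _ = K * σ ^ (p + 2) * ((C + 1) * N * √N ^ p + (C * √N ^ p + 1)) := by ring
      _ ≤ K * σ ^ (p + 2) *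
          ((C + 1) * N * √(N + 1) ^ p + (C * √(N + 1) ^ p + √(N + 1) ^ p)) := by gcongr
      _ = _ := by ring

lemma sumMomentBound_one : SumMomentBound 1 := by
  obtain ⟨C, hC, h2⟩ := sumMomentBound_zero.add_two
  refine ⟨√C, by positivity, fun Ω _ μ _ ι X σ hσ hX hind hmean hint hmom s => ?_⟩
  obtain ⟨hi, hb⟩ := h2 Ω μ ι X σ hσ hX hind hmean hint hmom s
  have hm : AEStronglyMeasurable (fun ω => ∑ i ∈ s, X i ω) μ :=
    (Finset.measurable_sum _ fun j _ => hX j).aestronglyMeasurable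
  refine ⟨integrable_pow_abs_of_le hm (by norm_num) hi,
    (integral_pow_abs_le hm (show 1 ≤ 0 + 2 by norm_num) hi).trans ?_⟩
  have : (((1 : ℕ) : ℝ) / ((0 + 2 : ℕ) : ℝ)) = 1 / 2 := by norm_num
  rw [this, ← Real.sqrt_eq_rpow, pow_one]
  refine (Real.sqrt_le_sqrt hb).trans_eq ?_
  rw [Real.sqrt_mul hC, zero_add, Real.sqrt_sq (by positivity)]

lemma sumMomentBound (p : ℕ) : SumMomentBound p := by
  induction p using Nat.twoStepInduction with
  | zero => exact sumMomentBound_zero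
  | one => exact sumMomentBound_one
  | more p hp _ => exact hp.add_two

/-- Marcinkiewicz–Zygmund type bound for the deviation of an empirical mean. -/
lemma exists_integral_abs_mean_sub_pow_le (r : ℕ) : ∃ C : ℝ, 0 ≤ C ∧
    ∀ (P : Measure ℝ) [IsProbabilityMeasure P] (g : ℝ → ℝ), Measurable g →
      Integrable (fun w => |g w| ^ max 2 r) P → ∀ n : ℕ, 1 ≤ n →
      Integrable (fun z : Fin n → ℝ => |(n : ℝ)⁻¹ * ∑ j, g (z j) - ∫ w, g w ∂P| ^ r)
        (Measure.pi fun _ => P) ∧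
      ∫ z : Fin n → ℝ, |(n : ℝ)⁻¹ * ∑ j, g (z j) - ∫ w, g w ∂P| ^ r ∂(Measure.pi fun _ => P)
        ≤ C * (∫ w, |g w| ^ max 2 r ∂P) ^ ((r : ℝ) / (max 2 r : ℕ))
          * (n : ℝ) ^ (-(r : ℝ) / 2) := by
  obtain ⟨C, hC, hbound⟩ := sumMomentBound r
  refine ⟨C * 2 ^ r, by positivity, fun P _ g hg hint n hn => ?_⟩
  set q := max 2 r with hq
  have hq2 : 2 ≤ q := le_max_left _ _
  set M := ∫ w, |g w| ^ q ∂P with hM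
  have hM0 : 0 ≤ M := integral_nonneg fun w => by positivity
  set τ : ℝ := M ^ ((1 : ℝ) / q) with hτ
  have hτ0 : 0 ≤ τ := by positivity
  have hτpow : ∀ m : ℕ, τ ^ m = M ^ ((m : ℝ) / q) := fun m => by
    rw [hτ, ← Real.rpow_natCast, ← Real.rpow_mul hM0]
    congr 1
    ring
  have hlow : ∀ m ≤ q, ∫ w, |g w| ^ m ∂P ≤ τ ^ m := fun m hm => by
    rw [hτpow]
    exact integral_pow_abs_le hg.aestronglyMeasurable hm hint
  have hgint : Integrable g P := by
    have := integrable_pow_abs_of_le hg.aestronglyMeasurable (show 1 ≤ q by omega) hint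
    exact this.mono' hg.aestronglyMeasurable (ae_of_all _ fun w => by simp)
  set e := ∫ w, g w ∂P with he
  have he1 : |e| ≤ τ := by
    have h1 := hlow 1 (by omega)
    simp only [pow_one] at h1
    exact (abs_integral_le_integral_abs).trans h1
  have hptw : ∀ (m : ℕ) (w : ℝ), |g w - e| ^ m ≤ 2 ^ (m - 1) * (|g w| ^ m + τ ^ m) :=
    fun m w => by
      refine le_trans ?_ (add_pow_le (abs_nonneg _) hτ0 m)
      gcongr
      exact (abs_sub _ _).trans (by gcongr)
  have hdomint : ∀ m ≤ q, Integrable (fun w => 2 ^ (m - 1) * (|g w| ^ m + τ ^ m)) P :=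
    fun m hm => ((integrable_pow_abs_of_le hg.aestronglyMeasurable hm hint).add
      (integrable_const _)).const_mul _
  have hcint : ∀ m ≤ q, Integrable (fun w => |g w - e| ^ m) P := fun m hm => by
    refine (hdomint m hm).mono' (by fun_prop) (ae_of_all _ fun w => ?_)
    rw [Real.norm_of_nonneg (by positivity)]
    exact hptw m w
  have hcmom : ∀ m ≤ q, ∫ w, |g w - e| ^ m ∂P ≤ (2 * τ) ^ m := fun m hm => by
    rcases Nat.eq_zero_or_pos m with rfl | hm0
    · simp
    refine (integral_mono (hcint m hm) (hdomint m hm) (hptw m)).trans ?_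
    rw [integral_const_mul, integral_add
      (integrable_pow_abs_of_le hg.aestronglyMeasurable hm hint) (integrable_const _)]
    simp only [integral_const, probReal_univ, one_smul]
    calc (2 : ℝ) ^ (m - 1) * (∫ w, |g w| ^ m ∂P + τ ^ m)
        ≤ 2 ^ (m - 1) * (τ ^ m + τ ^ m) := by gcongr; exact hlow m hm
      _ = (2 ^ (m - 1) * 2) * τ ^ m := by ring
      _ = (2 * τ) ^ m := by rw [← pow_succ, Nat.sub_add_cancel hm0, mul_pow]
  have heval : ∀ j : Fin n, MeasurePreserving (fun z : Fin n → ℝ => z j)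
      (Measure.pi fun _ => P) P := fun j => measurePreserving_eval (fun _ => P) j
  obtain ⟨hI, hB⟩ := hbound (Fin n → ℝ) (Measure.pi fun _ => P) (Fin n)
    (fun j z => g (z j) - e) (2 * τ) (by positivity) (fun j => by fun_prop)
    (iIndepFun_pi (X := fun _ w => g w - e) (μ := fun _ : Fin n => P) fun _ => by fun_prop)
    (fun j => by
      rw [integral_comp_eval (μ := fun _ : Fin n => P) (f := fun w => g w - e) (by fun_prop),
        integral_sub hgint (integrable_const _)]
      simp [he])
    (fun j => ((heval j).integrable_comp (hcint q le_rfl).aestronglyMeasurable).2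
      (hcint q le_rfl))
    (fun j m hm => by
      rw [integral_comp_eval (μ := fun _ : Fin n => P) (f := fun w => |g w - e| ^ m)
        (by fun_prop)]
      exact hcmom m hm) Finset.univ
  have hn0 : (0 : ℝ) < n := by exact_mod_cast hn
  have hrw : ∀ z : Fin n → ℝ, |(n : ℝ)⁻¹ * ∑ j, g (z j) - e| ^ r
      = (n : ℝ)⁻¹ ^ r * |∑ j, (g (z j) - e)| ^ r := fun z => by
    rw [← abs_of_pos (inv_pos.2 hn0), ← mul_pow, ← abs_mul, abs_of_pos (inv_pos.2 hn0),
      Finset.sum_sub_distrib, mul_sub]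
    simp [hn0.ne']
  simp only [hrw]
  refine ⟨hI.const_mul _, ?_⟩
  rw [integral_const_mul, ← hτpow]
  refine (mul_le_mul_of_nonneg_left hB (by positivity)).trans_eq ?_
  have hnpow : (n : ℝ) ^ (-(r : ℝ) / 2) = (n : ℝ)⁻¹ ^ r * √n ^ r := by
    rw [Real.sqrt_eq_rpow, ← Real.rpow_natCast, ← Real.rpow_natCast, ← Real.rpow_mul hn0.le,
      Real.inv_rpow hn0.le, ← Real.rpow_neg hn0.le, ← Real.rpow_add hn0]
    congr 1
    ring
  rw [hnpow, Finset.card_univ, Fintype.card_fin]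
  ring

lemma exists_integral_norm_mean_sub_pow_le (r : ℕ) : ∃ C : ℝ, 0 ≤ C ∧
    ∀ (P : Measure ℝ) [IsProbabilityMeasure P] (f : ℝ → ℂ), Measurable f →
      Integrable (fun w => ‖f w‖ ^ max 2 r) P → ∀ n : ℕ, 1 ≤ n →
      Integrable (fun z : Fin n → ℝ => ‖(n : ℂ)⁻¹ * ∑ j, f (z j) - ∫ w, f w ∂P‖ ^ r)
        (Measure.pi fun _ => P) ∧
      ∫ z : Fin n → ℝ, ‖(n : ℂ)⁻¹ * ∑ j, f (z j) - ∫ w, f w ∂P‖ ^ r ∂(Measure.pi fun _ => P)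
        ≤ C * (∫ w, ‖f w‖ ^ max 2 r ∂P) ^ ((r : ℝ) / (max 2 r : ℕ))
          * (n : ℝ) ^ (-(r : ℝ) / 2) := by
  obtain ⟨C, hC, hbound⟩ := exists_integral_abs_mean_sub_pow_le r
  refine ⟨2 ^ (r - 1) * (C + C), by positivity, fun P _ f hf hint n hn => ?_⟩
  have hfint : Integrable f P := by
    have := integrable_pow_abs_of_le (f := fun w => ‖f w‖) hf.norm.aestronglyMeasurable
      (show 1 ≤ max 2 r by omega) (by simpa using hint)
    exact this.mono' hf.aestronglyMeasurable (ae_of_all _ fun w => by simp)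
  have hre_int : Integrable (fun w => |(f w).re| ^ max 2 r) P := by
    refine hint.mono' (by fun_prop) (ae_of_all _ fun w => ?_)
    rw [Real.norm_of_nonneg (by positivity)]
    gcongr
    exact abs_re_le_norm _
  have him_int : Integrable (fun w => |(f w).im| ^ max 2 r) P := by
    refine hint.mono' (by fun_prop) (ae_of_all _ fun w => ?_)
    rw [Real.norm_of_nonneg (by positivity)]
    gcongr
    exact abs_im_le_norm _
  obtain ⟨I1, B1⟩ := hbound P (fun w => (f w).re) (by fun_prop) hre_int n hn
  obtain ⟨I2, B2⟩ := hbound P (fun w => (f w).im) (by fun_prop) him_int n hn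
  have hcast : (n : ℂ)⁻¹ = (((n : ℝ)⁻¹ : ℝ) : ℂ) := by simp
  have hptw : ∀ z : Fin n → ℝ, ‖(n : ℂ)⁻¹ * ∑ j, f (z j) - ∫ w, f w ∂P‖ ^ r
      ≤ 2 ^ (r - 1) * (|(n : ℝ)⁻¹ * ∑ j, (f (z j)).re - ∫ w, (f w).re ∂P| ^ r
        + |(n : ℝ)⁻¹ * ∑ j, (f (z j)).im - ∫ w, (f w).im ∂P| ^ r) := fun z => by
    refine le_trans ?_ (add_pow_le (abs_nonneg _) (abs_nonneg _) r)
    gcongr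
    refine (norm_le_abs_re_add_abs_im _).trans_eq ?_
    have h1 : (∫ w, f w ∂P).re = ∫ w, (f w).re ∂P := (integral_re hfint).symm
    have h2 : (∫ w, f w ∂P).im = ∫ w, (f w).im ∂P := (integral_im hfint).symm
    rw [sub_re, sub_im, hcast, re_ofReal_mul, im_ofReal_mul, re_sum, im_sum, h1, h2]
  have hdom := (I1.add I2).const_mul (2 ^ (r - 1))
  have hL : Integrable (fun z : Fin n → ℝ => ‖(n : ℂ)⁻¹ * ∑ j, f (z j) - ∫ w, f w ∂P‖ ^ r)
      (Measure.pi fun _ => P) := by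
    refine hdom.mono' ?_ (ae_of_all _ fun z => ?_)
    · exact Measurable.aestronglyMeasurable (by fun_prop)
    · rw [Real.norm_of_nonneg (by positivity)]
      exact hptw z
  refine ⟨hL, (integral_mono hL hdom hptw).trans ?_⟩
  rw [integral_const_mul]
  simp only [Pi.add_apply]
  rw [integral_add I1 I2]
  have hn0 : (0 : ℝ) ≤ n := Nat.cast_nonneg n
  have m1 : ∫ w, |(f w).re| ^ max 2 r ∂P ≤ ∫ w, ‖f w‖ ^ max 2 r ∂P :=
    integral_mono hre_int hint fun w => by
      have := abs_re_le_norm (f w)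
      dsimp only
      gcongr
  have m2 : ∫ w, |(f w).im| ^ max 2 r ∂P ≤ ∫ w, ‖f w‖ ^ max 2 r ∂P :=
    integral_mono him_int hint fun w => by
      have := abs_im_le_norm (f w)
      dsimp only
      gcongr
  rw [mul_assoc (2 ^ (r - 1) * (C + C)), mul_assoc (2 ^ (r - 1)), add_mul]
  gcongr
  · refine B1.trans ?_
    rw [← mul_assoc]
    gcongr
  · refine B2.trans ?_
    rw [← mul_assoc]
    gcongr

/-- A one-dimensional Sobolev bound for the `r`-th power of the supremum norm. -/
lemma iSup_norm_pow_le {G G' : ℝ → ℂ} (hG : ∀ t, HasDerivAt G (G' t) t) (hG' : Continuous G')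
    {T : ℝ} (hT : 0 < T) (r : ℕ) :
    (⨆ t : Set.Icc (-T) T, ‖G t‖) ^ (r + 1) ≤
      2 ^ r * (‖G 0‖ ^ (r + 1) + (2 * T) ^ r * ∫ s in Set.Icc (-T) T, ‖G' s‖ ^ (r + 1)) := by
  have hint : ∀ m : ℕ, IntegrableOn (fun s => ‖G' s‖ ^ m) (Set.Icc (-T) T) := fun m =>
    (hG'.norm.pow m).continuousOn.integrableOn_compact isCompact_Icc
  have hint1 : IntegrableOn (fun s => ‖G' s‖) (Set.Icc (-T) T) := by simpa using hint 1
  have hpt : ∀ t ∈ Set.Icc (-T) T, ‖G t‖ ≤ ‖G 0‖ + ∫ s in Set.Icc (-T) T, ‖G' s‖ := by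
    intro t ht
    have hftc := intervalIntegral.integral_eq_sub_of_hasDerivAt (a := 0) (b := t)
      (fun x _ => hG x) (hG'.intervalIntegrable _ _)
    have h1 : G t = G 0 + ∫ s in (0 : ℝ)..t, G' s := by rw [hftc]; ring
    rw [h1]
    refine (norm_add_le _ _).trans ?_
    gcongr
    refine intervalIntegral.norm_integral_le_integral_norm_uIoc.trans ?_
    refine setIntegral_mono_set hint1 (ae_of_all _ fun s => norm_nonneg _)
      (LE.le.eventuallyLE fun s hs => ?_)
    rcases Set.mem_uIoc.1 hs with h | h
    · exact ⟨by linarith [h.1], h.2.trans ht.2⟩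
    · exact ⟨ht.1.trans h.1.le, by linarith [h.2]⟩
  have hJ : (∫ s in Set.Icc (-T) T, ‖G' s‖) ^ (r + 1)
      ≤ (2 * T) ^ r * ∫ s in Set.Icc (-T) T, ‖G' s‖ ^ (r + 1) := by
    have hvol : (volume : Measure ℝ).real (Set.Icc (-T) T) = 2 * T := by
      rw [Real.volume_real_Icc_of_le (by linarith)]
      ring
    have key := (convexOn_pow (𝕜 := ℝ) (r + 1)).map_set_average_le (μ := volume)
      (t := Set.Icc (-T) T) (f := fun s => ‖G' s‖) (continuous_pow _).continuousOn isClosed_Ici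
      (by simp [hT]) (by simp) (ae_of_all _ fun s => norm_nonneg _) hint1 (hint (r + 1))
    rw [setAverage_eq, setAverage_eq, hvol, smul_eq_mul, smul_eq_mul, mul_pow] at key
    have h2T : (0 : ℝ) < 2 * T := by linarith
    calc (∫ s in Set.Icc (-T) T, ‖G' s‖) ^ (r + 1)
        = (2 * T) ^ (r + 1)
          * ((2 * T)⁻¹ ^ (r + 1) * (∫ s in Set.Icc (-T) T, ‖G' s‖) ^ (r + 1)) := by
          rw [← mul_assoc, ← mul_pow, mul_inv_cancel₀ h2T.ne', one_pow, one_mul]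
      _ ≤ (2 * T) ^ (r + 1) * ((2 * T)⁻¹ * ∫ s in Set.Icc (-T) T, ‖G' s‖ ^ (r + 1)) := by
          gcongr
      _ = _ := by rw [pow_succ]; field_simp
  have : Nonempty (Set.Icc (-T) T) := ⟨⟨0, by constructor <;> linarith⟩⟩
  calc (⨆ t : Set.Icc (-T) T, ‖G t‖) ^ (r + 1)
      ≤ (‖G 0‖ + ∫ s in Set.Icc (-T) T, ‖G' s‖) ^ (r + 1) := by
        gcongr
        · exact Real.iSup_nonneg fun t => norm_nonneg _
        · exact ciSup_le fun t => hpt t t.2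
    _ ≤ 2 ^ r * (‖G 0‖ ^ (r + 1) + (∫ s in Set.Icc (-T) T, ‖G' s‖) ^ (r + 1)) :=
        add_pow_le (norm_nonneg _) (integral_nonneg fun s => norm_nonneg _) (r + 1)
    _ ≤ _ := by gcongr

/-- The integrand of the `k`-th derivative of a characteristic function. -/
noncomputable def charFunTerm (k : ℕ) (t w : ℝ) : ℂ :=
  (Complex.I * w) ^ k * Complex.exp (Complex.I * t * w)

lemma continuous_charFunTerm (k : ℕ) :
    Continuous (fun x : ℝ × ℝ => charFunTerm k x.1 x.2) := by
  unfold charFunTerm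
  fun_prop

lemma norm_charFunTerm (k : ℕ) (t w : ℝ) : ‖charFunTerm k t w‖ = |w| ^ k := by
  have : Complex.I * t * w = ((t * w : ℝ) : ℂ) * Complex.I := by push_cast; ring
  rw [charFunTerm, this, norm_mul, norm_exp_ofReal_mul_I, norm_pow, norm_mul, norm_I]
  simp

lemma hasDerivAt_charFunTerm (k : ℕ) (t w : ℝ) :
    HasDerivAt (fun t => charFunTerm k t w) (charFunTerm (k + 1) t w) t := by
  have h1 : HasDerivAt (fun t : ℝ => Complex.I * (t : ℂ) * w) (Complex.I * w) t := by
    simpa using ((hasDerivAt_id t).ofReal_comp.const_mul Complex.I).mul_const (w : ℂ)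
  refine (h1.cexp.const_mul ((Complex.I * w) ^ k)).congr_deriv ?_
  rw [charFunTerm]
  ring

lemma measurable_charFunTerm (k : ℕ) (t : ℝ) : Measurable (charFunTerm k t) :=
  ((continuous_charFunTerm k).comp (by fun_prop : Continuous fun w : ℝ => (t, w))).measurable

lemma integrable_charFunTerm {P : Measure ℝ} {k : ℕ}
    (h : Integrable (fun w => |w| ^ k) P) (t : ℝ) : Integrable (charFunTerm k t) P :=
  h.mono' (measurable_charFunTerm k t).aestronglyMeasurable
    (ae_of_all _ fun w => (norm_charFunTerm k t w).le)

lemma continuous_integral_charFunTerm {P : Measure ℝ} {k : ℕ}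
    (h : Integrable (fun w => |w| ^ k) P) : Continuous fun t => ∫ w, charFunTerm k t w ∂P :=
  continuous_of_dominated (fun t => (measurable_charFunTerm k t).aestronglyMeasurable)
    (fun t => ae_of_all _ fun w => (norm_charFunTerm k t w).le) h
    (ae_of_all _ fun w =>
      (continuous_charFunTerm k).comp (by fun_prop : Continuous fun t : ℝ => (t, w)))

lemma hasDerivAt_integral_charFunTerm {P : Measure ℝ} {k : ℕ}
    (h : Integrable (fun w => |w| ^ k) P) (h' : Integrable (fun w => |w| ^ (k + 1)) P) (t : ℝ) :
    HasDerivAt (fun t => ∫ w, charFunTerm k t w ∂P) (∫ w, charFunTerm (k + 1) t w ∂P) t :=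
  (hasDerivAt_integral_of_dominated_loc_of_deriv_le (bound := fun w => |w| ^ (k + 1))
    Filter.univ_mem
    (Filter.Eventually.of_forall fun s => (measurable_charFunTerm k s).aestronglyMeasurable)
    (integrable_charFunTerm h t) (measurable_charFunTerm (k + 1) t).aestronglyMeasurable
    (ae_of_all _ fun w s _ => (norm_charFunTerm (k + 1) s w).le) h'
    (ae_of_all _ fun w s _ => hasDerivAt_charFunTerm k s w)).2

/-- The deviation of the `k`-th derivative of the empirical characteristic function. -/
noncomputable def empiricalDeviation (P : Measure ℝ) (k n : ℕ) (z : Fin n → ℝ) (t : ℝ) : ℂ :=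
  (n : ℂ)⁻¹ * ∑ j, charFunTerm k t (z j) - ∫ w, charFunTerm k t w ∂P

lemma hasDerivAt_empiricalDeviation {P : Measure ℝ} {k : ℕ}
    (h : Integrable (fun w => |w| ^ k) P) (h' : Integrable (fun w => |w| ^ (k + 1)) P)
    (n : ℕ) (z : Fin n → ℝ) (t : ℝ) :
    HasDerivAt (empiricalDeviation P k n z) (empiricalDeviation P (k + 1) n z t) t :=
  ((HasDerivAt.fun_sum fun j _ => hasDerivAt_charFunTerm k t (z j)).const_mul (n : ℂ)⁻¹).sub
    (hasDerivAt_integral_charFunTerm h h' t)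

lemma continuous_empiricalDeviation {P : Measure ℝ} {k : ℕ}
    (h : Integrable (fun w => |w| ^ k) P) (n : ℕ) :
    Continuous fun x : (Fin n → ℝ) × ℝ => empiricalDeviation P k n x.1 x.2 := by
  have h1 := (continuous_integral_charFunTerm h).comp
    (continuous_snd (X := Fin n → ℝ) (Y := ℝ))
  have h2 : ∀ j : Fin n, Continuous fun x : (Fin n → ℝ) × ℝ => charFunTerm k x.2 (x.1 j) :=
    fun j => (continuous_charFunTerm k).comp
      (by fun_prop : Continuous fun x : (Fin n → ℝ) × ℝ => (x.2, x.1 j))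
  exact (continuous_const.mul (continuous_finsetSum _ fun j _ => h2 j)).sub h1

/-- Sobolev bound and Fubini reduce the maximal inequality to pointwise moment bounds. -/
lemma integral_iSup_empiricalDeviation_pow_le {P : Measure ℝ} [IsProbabilityMeasure P] {k : ℕ}
    (h : Integrable (fun w => |w| ^ k) P) (h' : Integrable (fun w => |w| ^ (k + 1)) P)
    {n r : ℕ} {T A B : ℝ} (hT : 0 < T)
    (hAint : Integrable (fun z => ‖empiricalDeviation P k n z 0‖ ^ (r + 1))
      (Measure.pi fun _ => P))
    (hA : ∫ z, ‖empiricalDeviation P k n z 0‖ ^ (r + 1) ∂(Measure.pi fun _ => P) ≤ A)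
    (hBint : ∀ t, Integrable (fun z => ‖empiricalDeviation P (k + 1) n z t‖ ^ (r + 1))
      (Measure.pi fun _ => P))
    (hB : ∀ t, ∫ z, ‖empiricalDeviation P (k + 1) n z t‖ ^ (r + 1) ∂(Measure.pi fun _ => P) ≤ B) :
    ∫ z, (⨆ t : Set.Icc (-T) T, ‖empiricalDeviation P k n z t‖) ^ (r + 1)
      ∂(Measure.pi fun _ => P) ≤ 2 ^ r * (A + (2 * T) ^ (r + 1) * B) := by
  set Q : Measure (Fin n → ℝ) := Measure.pi fun _ => P
  set ν : Measure ℝ := volume.restrict (Set.Icc (-T) T) with hν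
  have hm : AEStronglyMeasurable
      (fun x : (Fin n → ℝ) × ℝ => ‖empiricalDeviation P (k + 1) n x.1 x.2‖ ^ (r + 1))
      (Q.prod ν) :=
    ((continuous_empiricalDeviation h' n).norm.pow (r + 1)).aestronglyMeasurable
  have hprod : Integrable
      (fun x : (Fin n → ℝ) × ℝ => ‖empiricalDeviation P (k + 1) n x.1 x.2‖ ^ (r + 1))
      (Q.prod ν) := by
    rw [integrable_prod_iff' hm]
    refine ⟨ae_of_all _ hBint, Integrable.of_bound (C := B) ?_ (ae_of_all _ fun t => ?_)⟩
    · exact hm.norm.prod_swap.integral_prod_right'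
    · rw [Real.norm_of_nonneg (integral_nonneg fun z => norm_nonneg _)]
      simpa using hB t
  have hint : Integrable
      (fun z => (2 * T) ^ r * ∫ t, ‖empiricalDeviation P (k + 1) n z t‖ ^ (r + 1) ∂ν) Q :=
    hprod.integral_prod_left.const_mul _
  have hdom : Integrable (fun z => 2 ^ r * (‖empiricalDeviation P k n z 0‖ ^ (r + 1)
      + (2 * T) ^ r * ∫ t, ‖empiricalDeviation P (k + 1) n z t‖ ^ (r + 1) ∂ν)) Q :=
    (hAint.add hint).const_mul _
  have hptw : ∀ z : Fin n → ℝ,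
      (⨆ t : Set.Icc (-T) T, ‖empiricalDeviation P k n z t‖) ^ (r + 1) ≤
        2 ^ r * (‖empiricalDeviation P k n z 0‖ ^ (r + 1)
          + (2 * T) ^ r * ∫ t, ‖empiricalDeviation P (k + 1) n z t‖ ^ (r + 1) ∂ν) := fun z => by
    have hc := (continuous_empiricalDeviation h' n).comp (Continuous.prodMk_right z)
    exact iSup_norm_pow_le (hasDerivAt_empiricalDeviation h h' n z) hc hT r
  refine (integral_mono_of_nonneg
    (ae_of_all _ fun z => pow_nonneg (Real.iSup_nonneg fun t => norm_nonneg _) _) hdom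
    (ae_of_all _ hptw)).trans ?_
  rw [integral_const_mul, integral_add hAint hint, integral_const_mul,
    integral_integral_swap hprod]
  have hswap : ∫ t, ∫ z, ‖empiricalDeviation P (k + 1) n z t‖ ^ (r + 1) ∂Q ∂ν ≤ 2 * T * B := by
    refine (integral_mono hprod.integral_prod_right (integrable_const B) hB).trans_eq ?_
    rw [integral_const, hν, measureReal_restrict_apply_univ,
      Real.volume_real_Icc_of_le (by linarith), smul_eq_mul]
    ring
  rw [pow_succ (2 * T), mul_assoc ((2 * T) ^ r)]
  gcongr

/-- Maximal inequality for the empirical characteristic function and its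
derivatives. For integers `k ≥ 0` and `r ≥ 1` there is a constant `C` depending only on `k`
and `r` such that for every probability law `P` on `ℝ` with
`E[|Z|^{(k+1)·max(2,r)}] < ∞`, every sample size `n ≥ 1` and every bandwidth `0 < h ≤ 1`,
`E[(sup_{t∈[−1/h,1/h]} |φ̂⁽ᵏ⁾(t) − φ⁽ᵏ⁾(t)|)^r]
  ≤ C·(‖|x|^{k+1}‖_{L_{2∨r}(P)}^r + ‖|x|^k‖_{L_{2∨r}(P)}^r)·h^{−r}·n^{−r/2}`,
where the expectation is over an i.i.d. sample of law `P` (the product measure). -/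
theorem stmt3 (k r : ℕ) (hr : 1 ≤ r) :
    ∃ C : ℝ, 0 < C ∧
      ∀ (P : Measure ℝ) [IsProbabilityMeasure P],
        Integrable (fun z : ℝ => |z| ^ ((k + 1) * max 2 r)) P →
        ∀ n : ℕ, 1 ≤ n → ∀ h : ℝ, 0 < h → h ≤ 1 →
          (∫ z : Fin n → ℝ,
              (⨆ t : Set.Icc (-(1 / h)) (1 / h),
                ‖(n : ℂ)⁻¹ * ∑ j, (Complex.I * z j) ^ k
                      * Complex.exp (Complex.I * (t : ℝ) * z j)
                  - ∫ w : ℝ, (Complex.I * w) ^ k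
                      * Complex.exp (Complex.I * (t : ℝ) * w) ∂P‖) ^ r
            ∂(Measure.pi fun _ : Fin n => P))
          ≤ C * ((∫ w : ℝ, |w| ^ ((k + 1) * max 2 r) ∂P) ^ ((r : ℝ) / (max 2 r : ℕ))
              + (∫ w : ℝ, |w| ^ (k * max 2 r) ∂P) ^ ((r : ℝ) / (max 2 r : ℕ)))
            * h⁻¹ ^ r * (n : ℝ) ^ (-(r : ℝ) / 2) := by
  obtain ⟨r, rfl⟩ : ∃ m, r = m + 1 := ⟨r - 1, by omega⟩
  obtain ⟨C, hC, hmean⟩ := exists_integral_norm_mean_sub_pow_le (r + 1)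
  refine ⟨2 ^ r * 2 ^ (r + 1) * C + 1, by positivity, fun P _ hP n hn h hh hh1 => ?_⟩
  have hid : ∀ μ : Measure ℝ, AEStronglyMeasurable (fun w : ℝ => w) μ := fun μ =>
    measurable_id.aestronglyMeasurable
  set q := max 2 (r + 1) with hq
  have hq1 : 1 ≤ q := by omega
  have hPk : Integrable (fun w : ℝ => |w| ^ (k * q)) P :=
    integrable_pow_abs_of_le (hid P) (Nat.mul_le_mul_right q k.le_succ) hP
  have hk1 : Integrable (fun w : ℝ => |w| ^ (k + 1)) P :=
    integrable_pow_abs_of_le (hid P) (Nat.le_mul_of_pos_right _ hq1) hP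
  have hk : Integrable (fun w : ℝ => |w| ^ k) P :=
    integrable_pow_abs_of_le (hid P) k.le_succ hk1
  have hpow : ∀ (m : ℕ) (t w : ℝ), ‖charFunTerm m t w‖ ^ q = |w| ^ (m * q) := fun m t w => by
    rw [norm_charFunTerm, pow_mul]
  have hdev : ∀ (m : ℕ), Integrable (fun w : ℝ => |w| ^ (m * q)) P → ∀ t : ℝ,
      Integrable (fun z => ‖empiricalDeviation P m n z t‖ ^ (r + 1)) (Measure.pi fun _ => P) ∧
      ∫ z, ‖empiricalDeviation P m n z t‖ ^ (r + 1) ∂(Measure.pi fun _ => P)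
        ≤ C * (∫ w : ℝ, |w| ^ (m * q) ∂P) ^ (((r + 1 : ℕ) : ℝ) / (q : ℕ))
          * (n : ℝ) ^ (-((r + 1 : ℕ) : ℝ) / 2) := fun m hm t => by
    have := hmean P (charFunTerm m t) (measurable_charFunTerm m t)
      (by simpa only [hpow] using hm) n hn
    simpa only [hpow, empiricalDeviation] using this
  have hmain := integral_iSup_empiricalDeviation_pow_le hk hk1 (one_div_pos.2 hh)
    (hdev k hPk 0).1 (hdev k hPk 0).2 (fun t => (hdev (k + 1) hP t).1)
    (fun t => (hdev (k + 1) hP t).2)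
  refine hmain.trans ?_
  set a := (∫ w : ℝ, |w| ^ (k * q) ∂P) ^ (((r + 1 : ℕ) : ℝ) / (q : ℕ))
  set b := (∫ w : ℝ, |w| ^ ((k + 1) * q) ∂P) ^ (((r + 1 : ℕ) : ℝ) / (q : ℕ))
  set N := (n : ℝ) ^ (-((r + 1 : ℕ) : ℝ) / 2)
  have ha : 0 ≤ a := Real.rpow_nonneg (integral_nonneg fun w => by positivity) _
  have hb : 0 ≤ b := Real.rpow_nonneg (integral_nonneg fun w => by positivity) _
  have hN : 0 ≤ N := Real.rpow_nonneg (Nat.cast_nonneg n) _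
  have hinv : 1 ≤ h⁻¹ ^ (r + 1) := one_le_pow₀ ((one_le_inv₀ hh).2 hh1)
  have htwo : (1 : ℝ) ≤ 2 ^ (r + 1) := one_le_pow₀ (by norm_num)
  have hone : (1 : ℝ) ≤ 2 ^ (r + 1) * h⁻¹ ^ (r + 1) := one_le_mul_of_one_le_of_one_le htwo hinv
  rw [one_div, mul_pow]
  calc 2 ^ r * (C * a * N + 2 ^ (r + 1) * h⁻¹ ^ (r + 1) * (C * b * N))
      ≤ 2 ^ r * (2 ^ (r + 1) * h⁻¹ ^ (r + 1) * (C * a * N)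
        + 2 ^ (r + 1) * h⁻¹ ^ (r + 1) * (C * b * N)) := by
        have := le_mul_of_one_le_left (show 0 ≤ C * a * N by positivity) hone
        gcongr
    _ = (2 ^ r * 2 ^ (r + 1) * C) * (b + a) * h⁻¹ ^ (r + 1) * N := by ring
    _ ≤ (2 ^ r * 2 ^ (r + 1) * C + 1) * (b + a) * h⁻¹ ^ (r + 1) * N := by
        gcongr
        linarith
end

section
/- Fix strictly positive constants β, L, K, Λ, Σ, Γ and 0 < η < 1/(2Σ²). Let 𝒯 be the class of all triples (γ, σ², ρ) with |γ| ≤ Γ, σ ∈ (0, Σ], ρ = λ f where λ ∈ (0, Λ], f is a probability density with ∫_ℝ |t|^β |φ_f(t)| dt ≤ L, ∫_ℝ x^{12} f(x) dx ≤ K, and the second derivative of φ_f is integrable. For a sample Z₁, …, Zₙ of i.i.d. real random variables with characteristic function φ(t) = exp(iγt − σ²t²/2 + λ(φ_f(t) − 1)), let φ̂(t) = n^{−1}∑_{j=1}^{n} e^{itZ_j}, h = (η log n)^{−1/2}, Mₙ = (log log 3n) h^{−2}, and define σ̂² = ∫_{−1/h}^{1/h} max{min{Mₙ, log|φ̂(t)|},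 −Mₙ} h³ v(ht) dt, where v is a continuous real-valued function supported on [−1,1] with ∫_{−1}^{1} v(t)dt = 0, ∫_{−1}^{1} (−t²/2) v(t)dt = 1, and v(t) = O(t^β) as t → 0. Then there exist a constant C and n₀ (depending only on β, L, K, Λ, Σ, Γ, η, v) such that for all n ≥ n₀, sup over (γ, σ², ρ) ∈ 𝒯 of E[(σ̂² − σ²)²] ≤ C (log n)^{−β−3}. -/
open MeasureTheory Complex Asymptotics

/-- The truncated logarithm is relatively Lipschitz at points whose logarithm is not truncated. -/
theorem abs_clamp_log_sub_log_le {a b M : ℝ} (hb : 0 < b) (hM : |Real.log b| ≤ M) :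
    |max (min M (Real.log a)) (-M) - Real.log b| ≤ (2 + 4 * M) * (|a - b| / b) := by
  have hM0 : 0 ≤ M := (abs_nonneg _).trans hM
  have hr : 0 ≤ |a - b| / b := by positivity
  obtain ⟨hM1, hM2⟩ := abs_le.1 hM
  rcases le_or_gt (|a - b|) (b / 2) with hab | hab
  · have ha : b / 2 ≤ a := by linarith [neg_abs_le (a - b)]
    have ha0 : 0 < a := by linarith
    have h1 : Real.log a - Real.log b ≤ |a - b| / b := by
      rw [← Real.log_div ha0.ne' hb.ne']
      refine (Real.log_le_sub_one_of_pos (by positivity)).trans ?_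
      rw [div_sub_one hb.ne']
      gcongr
      exact le_abs_self _
    have h2 : Real.log b - Real.log a ≤ 2 * (|a - b| / b) := by
      rw [← Real.log_div hb.ne' ha0.ne']
      refine (Real.log_le_sub_one_of_pos (by positivity)).trans ?_
      rw [div_sub_one ha0.ne', div_le_iff₀ ha0]
      have : |a - b| / b * b = |a - b| := by field_simp
      nlinarith [neg_abs_le (a - b), mul_le_mul_of_nonneg_left ha hr]
    have h3 : |max (min M (Real.log a)) (-M) - Real.log b| ≤ 2 * (|a - b| / b) := by
      rw [abs_le]
      grind
    nlinarith
  · have h1 : 1 / 2 ≤ |a - b| / b := by rw [le_div_iff₀ hb]; linarith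
    have h3 : |max (min M (Real.log a)) (-M) - Real.log b| ≤ 2 * M := by
      rw [abs_le]
      grind
    nlinarith

/-- The Cauchy–Schwarz inequality against a constant function. -/
theorem sq_intervalIntegral_le {F : ℝ → ℝ} {a b : ℝ} (hab : a < b) (hF : Continuous F) :
    (∫ t in a..b, F t) ^ 2 ≤ (b - a) * ∫ t in a..b, F t ^ 2 := by
  have hba : 0 < b - a := sub_pos.2 hab
  set m := (∫ t in a..b, F t) / (b - a) with hm
  have h0 : 0 ≤ ∫ t in a..b, (F t - m) ^ 2 :=
    intervalIntegral.integral_nonneg hab.le fun _ _ => sq_nonneg _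
  have h1 : ∫ t in a..b, (F t - m) ^ 2
      = (∫ t in a..b, F t ^ 2) - 2 * m * (∫ t in a..b, F t) + (b - a) * m ^ 2 := by
    have : (fun t => (F t - m) ^ 2) = fun t => F t ^ 2 - 2 * m * F t + m ^ 2 := by
      ext t; ring
    rw [this, intervalIntegral.integral_add
      ((by fun_prop : Continuous fun t => F t ^ 2 - 2 * m * F t).intervalIntegrable _ _)
      (by simp), intervalIntegral.integral_sub
      ((by fun_prop : Continuous fun t => F t ^ 2).intervalIntegrable _ _)
      ((by fun_prop : Continuous fun t => 2 * m * F t).intervalIntegrable _ _)]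
    simp
  have hI : ∫ t in a..b, F t = m * (b - a) := by rw [hm]; field_simp
  rw [h1, hI] at h0
  rw [hI]
  nlinarith

/-- The variance of an empirical mean is at most the second moment divided by the sample size. -/
theorem integral_sq_mean_sub_le {P : Measure ℝ} [IsProbabilityMeasure P] {n : ℕ} (hn : 0 < n)
    {g : ℝ → ℝ} (hg : MemLp g 2 P) :
    ∫ z : Fin n → ℝ, ((n : ℝ)⁻¹ * ∑ j, g (z j) - ∫ x, g x ∂P) ^ 2 ∂(Measure.pi fun _ => P)
      ≤ (n : ℝ)⁻¹ * ∫ x, g x ^ 2 ∂P := by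
  have hn' : (n : ℝ) ≠ 0 := by positivity
  have hint : ∀ j : Fin n, Integrable (fun z : Fin n → ℝ => g (z j)) (Measure.pi fun _ => P) :=
    fun j => (measurePreserving_eval (fun _ : Fin n => P) j).integrable_comp_of_integrable
      (hg.integrable (by norm_num))
  have hmean : ∫ z : Fin n → ℝ, (∑ j, g (z j)) ∂(Measure.pi fun _ => P)
      = n * ∫ x, g x ∂P := by
    rw [integral_finsetSum _ fun j _ => hint j]
    simp [integral_comp_eval (μ := fun _ : Fin n => P) (f := g) hg.aestronglyMeasurable]
  have hvar := ProbabilityTheory.variance_sum_pi (μ := fun _ : Fin n => P) (X := fun _ => g)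
    (fun _ => hg)
  rw [ProbabilityTheory.variance_eq_integral (by
    simp only [Finset.sum_fn]
    exact (integrable_finsetSum _ fun j _ => hint j).aemeasurable)] at hvar
  simp only [Finset.sum_apply, hmean, Finset.sum_const, Finset.card_univ, Fintype.card_fin,
    nsmul_eq_mul] at hvar
  have hle := ProbabilityTheory.variance_le_expectation_sq (X := g) (μ := P) hg.1
  have : (fun z : Fin n → ℝ => ((n : ℝ)⁻¹ * ∑ j, g (z j) - ∫ x, g x ∂P) ^ 2)
      = fun z => ((n : ℝ)⁻¹) ^ 2 * (∑ j, g (z j) - n * ∫ x, g x ∂P) ^ 2 := by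
    ext z; field_simp
  rw [this, integral_const_mul, hvar]
  calc ((n : ℝ)⁻¹) ^ 2 * (n * ProbabilityTheory.variance g P)
      = (n : ℝ)⁻¹ * ProbabilityTheory.variance g P := by field_simp
    _ ≤ _ := by gcongr; exact hle

theorem exp_I_mul_mul_eq (t x : ℝ) :
    exp (I * t * x) = (Real.cos (t * x) : ℂ) + (Real.sin (t * x) : ℂ) * I := by
  rw [ofReal_cos, ofReal_sin, ← exp_mul_I]; push_cast; ring_nf

theorem norm_exp_I_mul_mul (t x : ℝ) : ‖exp (I * t * x)‖ = 1 := by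
  rw [show I * t * x = ((t * x : ℝ) : ℂ) * I by push_cast; ring, norm_exp_ofReal_mul_I]

theorem integrable_exp_I_mul_mul (P : Measure ℝ) [IsProbabilityMeasure P] (t : ℝ) :
    Integrable (fun x : ℝ => exp (I * t * x)) P :=
  Integrable.of_bound (by fun_prop : Continuous fun x : ℝ => exp (I * t * x)).aestronglyMeasurable
    1 (by simp [norm_exp_I_mul_mul])

/-- The mean squared error of the empirical characteristic function is at most `1 / n`. -/
theorem integral_sq_empirical_charFun_sub_le (P : Measure ℝ) [IsProbabilityMeasure P] {n : ℕ}
    (hn : 0 < n) (t : ℝ) :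
    ∫ z : Fin n → ℝ, ‖(n : ℂ)⁻¹ * ∑ j, exp (I * t * z j) - ∫ x, exp (I * t * x) ∂P‖ ^ 2
      ∂(Measure.pi fun _ => P) ≤ (n : ℝ)⁻¹ := by
  have hcm : MemLp (fun x => Real.cos (t * x)) 2 P :=
    MemLp.of_bound (by fun_prop : Continuous fun x => Real.cos (t * x)).aestronglyMeasurable 1
      (by simp [Real.abs_cos_le_one])
  have hsm : MemLp (fun x => Real.sin (t * x)) 2 P :=
    MemLp.of_bound (by fun_prop : Continuous fun x => Real.sin (t * x)).aestronglyMeasurable 1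
      (by simp [Real.abs_sin_le_one])
  have hmean : ∫ x, exp (I * t * x) ∂P
      = ((∫ x, Real.cos (t * x) ∂P : ℝ) : ℂ) + ((∫ x, Real.sin (t * x) ∂P : ℝ) : ℂ) * I := by
    have hc : Integrable (fun x => (Real.cos (t * x) : ℂ)) P :=
      (hcm.integrable (by norm_num)).ofReal
    have hs : Integrable (fun x => (Real.sin (t * x) : ℂ)) P :=
      (hsm.integrable (by norm_num)).ofReal
    simp only [exp_I_mul_mul_eq]
    rw [integral_add hc (hs.mul_const I), integral_mul_const, integral_complex_ofReal,
      integral_complex_ofReal]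
  have hsplit : ∀ z : Fin n → ℝ,
      ‖(n : ℂ)⁻¹ * ∑ j, exp (I * t * z j) - ∫ x, exp (I * t * x) ∂P‖ ^ 2
      = ((n : ℝ)⁻¹ * ∑ j, Real.cos (t * z j) - ∫ x, Real.cos (t * x) ∂P) ^ 2
        + ((n : ℝ)⁻¹ * ∑ j, Real.sin (t * z j) - ∫ x, Real.sin (t * x) ∂P) ^ 2 := by
    intro z
    have : (n : ℂ)⁻¹ * ∑ j, exp (I * t * z j) - ∫ x, exp (I * t * x) ∂P
        = (((n : ℝ)⁻¹ * ∑ j, Real.cos (t * z j) - ∫ x, Real.cos (t * x) ∂P : ℝ) : ℂ)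
          + (((n : ℝ)⁻¹ * ∑ j, Real.sin (t * z j) - ∫ x, Real.sin (t * x) ∂P : ℝ) : ℂ) * I := by
      rw [hmean]
      simp only [exp_I_mul_mul_eq, Finset.sum_add_distrib, ← Finset.sum_mul]
      push_cast
      ring
    rw [this, norm_add_mul_I, Real.sq_sqrt (by positivity)]
  have hmeas : ∀ g : ℝ → ℝ, Continuous g → (∀ x, |g x| ≤ 1) → Integrable
      (fun z : Fin n → ℝ => ((n : ℝ)⁻¹ * ∑ j, g (z j) - ∫ x, g x ∂P) ^ 2)
      (Measure.pi fun _ => P) := by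
    intro g hg hb
    have hmem : MemLp (fun z : Fin n → ℝ => (n : ℝ)⁻¹ * ∑ j, g (z j) - ∫ x, g x ∂P) 2
        (Measure.pi fun _ => P) := by
      refine MemLp.of_bound (Continuous.aestronglyMeasurable (by fun_prop))
        (|(n : ℝ)⁻¹| * n + |∫ x, g x ∂P|) (Filter.Eventually.of_forall fun z => ?_)
      refine (norm_sub_le _ _).trans ?_
      rw [Real.norm_eq_abs, Real.norm_eq_abs, abs_mul]
      gcongr
      refine (Finset.abs_sum_le_sum_abs _ _).trans ((Finset.sum_le_sum fun j _ => hb (z j)).trans ?_)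
      simp
    exact hmem.integrable_sq
  simp only [hsplit]
  rw [integral_add (hmeas (fun x => Real.cos (t * x)) (by fun_prop) fun x => Real.abs_cos_le_one _)
    (hmeas (fun x => Real.sin (t * x)) (by fun_prop) fun x => Real.abs_sin_le_one _)]
  refine (add_le_add (integral_sq_mean_sub_le hn hcm) (integral_sq_mean_sub_le hn hsm)).trans ?_
  rw [← mul_add, ← integral_add hcm.integrable_sq hsm.integrable_sq]
  simp

theorem exists_abs_le_mul_rpow {v : ℝ → ℝ} {β : ℝ} (hβ : 0 < β) (hv_cont : Continuous v)
    (hv_supp : Function.support v ⊆ Set.Icc (-1 : ℝ) 1)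
    (hv_O : v =O[nhds 0] fun t : ℝ => |t| ^ β) :
    ∃ V : ℝ, 0 < V ∧ (∀ t, |v t| ≤ V) ∧ ∀ t, |v t| ≤ V * |t| ^ β := by
  obtain ⟨B, hB⟩ := hv_cont.bounded_above_of_compact_support
    (HasCompactSupport.of_support_subset_isCompact isCompact_Icc hv_supp)
  obtain ⟨c, hc⟩ := hv_O.bound
  obtain ⟨δ, hδ, hδc⟩ := Metric.eventually_nhds_iff.1 hc
  have hB0 : 0 ≤ B := (norm_nonneg _).trans (hB 0)
  refine ⟨max (max c 1) (max B (B / δ ^ β)), by positivity, fun t => (hB t).trans (by simp),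
    fun t => ?_⟩
  rcases lt_or_ge (|t|) δ with ht | ht
  · have := hδc (y := t) (by simpa [Real.dist_eq] using ht)
    rw [Real.norm_eq_abs, Real.norm_eq_abs, abs_of_nonneg (by positivity : 0 ≤ |t| ^ β)] at this
    refine this.trans ?_
    gcongr
    simp
  · calc |v t| ≤ B := hB t
      _ = B / δ ^ β * δ ^ β := by field_simp
      _ ≤ max (max c 1) (max B (B / δ ^ β)) * |t| ^ β := by
        gcongr
        simp

theorem continuous_integral_exp_I_mul_mul {f : ℝ → ℝ} (hf : Integrable f) :
    Continuous fun t : ℝ => ∫ x : ℝ, exp (I * t * x) * f x := by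
  refine continuous_of_dominated (bound := fun x => |f x|) (fun t => ?_) (fun t => ?_) hf.abs ?_
  · exact (by fun_prop : Continuous fun x : ℝ => exp (I * t * x)).aestronglyMeasurable.mul
      hf.ofReal.aestronglyMeasurable
  · exact Filter.Eventually.of_forall fun x => by simp [norm_exp_I_mul_mul]
  · exact Filter.Eventually.of_forall fun x => by fun_prop

theorem norm_integral_exp_I_mul_mul_le {f : ℝ → ℝ} (hf0 : ∀ x, 0 ≤ f x) (t : ℝ) :
    ‖∫ x : ℝ, exp (I * t * x) * f x‖ ≤ ∫ x, f x := by
  refine (norm_integral_le_integral_norm _).trans (le_of_eq ?_)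
  simp [norm_exp_I_mul_mul, abs_of_nonneg (hf0 _)]

/-- Bias of the smoothed log-modulus of the characteristic function as a proxy for `σ ^ 2`. -/
theorem abs_integral_smoothed_log_sub_le {β L V σ lam h : ℝ} {v r p : ℝ → ℝ}
    (hlam : 0 ≤ lam) (hh : 0 < h) (hV : 0 ≤ V) (hv_cont : Continuous v)
    (hv_int0 : (∫ t in (-1 : ℝ)..1, v t) = 0)
    (hv_int2 : (∫ t in (-1 : ℝ)..1, (-(t ^ 2) / 2) * v t) = 1)
    (hvV : ∀ t, |v t| ≤ V * |t| ^ β) (hr : Continuous r) (hrp : ∀ t, |r t| ≤ p t)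
    (hp : Integrable fun t => |t| ^ β * p t) (hpL : (∫ t, |t| ^ β * p t) ≤ L) :
    |(∫ t in (-(1 / h))..(1 / h),
        (-(σ ^ 2 * t ^ 2 / 2) + lam * (r t - 1)) * (h ^ 3 * v (h * t))) - σ ^ 2|
      ≤ lam * (h ^ (3 + β) * (V * L)) := by
  set g : ℝ → ℝ := fun u => h * (σ ^ 2 * ((-(u ^ 2) / 2) * v u) - lam * h ^ 2 * v u) with hg
  have hgc : Continuous g := by fun_prop
  have hg_int : ∫ t in (-(1 / h))..(1 / h), g (h * t) = σ ^ 2 := by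
    rw [intervalIntegral.integral_comp_mul_left _ hh.ne']
    have h1 : h * (1 / h) = 1 := by field_simp
    have h2 : h * -(1 / h) = -1 := by rw [mul_neg, h1]
    rw [h1, h2, hg, intervalIntegral.integral_const_mul, intervalIntegral.integral_sub
      ((by fun_prop : Continuous fun u => σ ^ 2 * ((-(u ^ 2) / 2) * v u)).intervalIntegrable _ _)
      ((by fun_prop : Continuous fun u => lam * h ^ 2 * v u).intervalIntegrable _ _),
      intervalIntegral.integral_const_mul, intervalIntegral.integral_const_mul, hv_int0, hv_int2]
    simp [hh.ne']
  have hsplit : (fun t => (-(σ ^ 2 * t ^ 2 / 2) + lam * (r t - 1)) * (h ^ 3 * v (h * t)))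
      = fun t => g (h * t) + lam * (r t * (h ^ 3 * v (h * t))) := by
    ext t; simp only [hg]; ring
  rw [hsplit, intervalIntegral.integral_add
    ((by fun_prop : Continuous fun t => g (h * t)).intervalIntegrable _ _)
    ((by fun_prop : Continuous fun t => lam * (r t * (h ^ 3 * v (h * t)))).intervalIntegrable _ _),
    hg_int, add_sub_cancel_left, intervalIntegral.integral_const_mul, abs_mul, abs_of_nonneg hlam]
  gcongr
  have hle : -(1 / h) ≤ 1 / h := neg_le_self (by positivity)
  have hpt : ∀ t, ‖r t * (h ^ 3 * v (h * t))‖ ≤ h ^ (3 + β) * V * (|t| ^ β * p t) := by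
    intro t
    have hp0 : 0 ≤ p t := (abs_nonneg _).trans (hrp t)
    rw [Real.norm_eq_abs, abs_mul, abs_mul, abs_of_pos (by positivity : 0 < h ^ 3)]
    calc |r t| * (h ^ 3 * |v (h * t)|) ≤ p t * (h ^ 3 * (V * |h * t| ^ β)) := by
          gcongr
          · exact hrp t
          · exact hvV _
      _ = _ := by
          rw [abs_mul, abs_of_pos hh, Real.mul_rpow hh.le (abs_nonneg _), Real.rpow_add hh,
            show h ^ (3 : ℝ) = h ^ 3 by norm_cast]
          ring
  have hint : Integrable fun t => h ^ (3 + β) * V * (|t| ^ β * p t) := hp.const_mul _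
  have hnn : ∀ t, 0 ≤ h ^ (3 + β) * V * (|t| ^ β * p t) := fun t => (norm_nonneg _).trans (hpt t)
  refine (intervalIntegral.norm_integral_le_of_norm_le hle
    (Filter.Eventually.of_forall fun t _ => hpt t) hint.intervalIntegrable).trans ?_
  rw [intervalIntegral.integral_of_le hle]
  refine (setIntegral_le_integral hint (Filter.Eventually.of_forall hnn)).trans ?_
  rw [integral_const_mul, mul_assoc]
  gcongr

/-- Stochastic error of the smoothed truncated log-modulus, for an arbitrary estimate `ψ` of `φ`. -/
theorem abs_integral_clamp_log_sub_le {φ ψ : ℝ → ℂ} {w : ℝ → ℝ} {R M W c : ℝ}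
    (hR : 0 ≤ R) (hc : 0 < c) (hφ : Continuous φ) (hψ : Continuous ψ) (hw : Continuous w)
    (hwW : ∀ t, |w t| ≤ W) (hφc : ∀ t, |t| ≤ R → c ≤ ‖φ t‖) (hφ0 : ∀ t, φ t ≠ 0)
    (hφM : ∀ t, |t| ≤ R → |Real.log ‖φ t‖| ≤ M) :
    |(∫ t in (-R)..R, max (min M (Real.log ‖ψ t‖)) (-M) * w t)
        - ∫ t in (-R)..R, Real.log ‖φ t‖ * w t|
      ≤ (2 + 4 * M) / c * W * ∫ t in (-R)..R, ‖ψ t - φ t‖ := by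
  have hM : 0 ≤ M := (abs_nonneg _).trans (hφM 0 (by simpa))
  have hI : IntervalIntegrable (fun t => max (min M (Real.log ‖ψ t‖)) (-M) * w t) volume (-R) R := by
    rw [intervalIntegrable_iff]
    refine IntegrableOn.of_bound (by simp) ?_ (M * W) (Filter.Eventually.of_forall fun t => ?_)
    · have : Measurable ψ := hψ.measurable
      have : Measurable w := hw.measurable
      exact Measurable.aestronglyMeasurable (by fun_prop)
    · rw [norm_mul]
      gcongr
      · rw [Real.norm_eq_abs, abs_le]
        grind
      · exact hwW t
  have hφl : Continuous fun t => Real.log ‖φ t‖ :=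
    hφ.norm.log fun t => norm_ne_zero_iff.2 (hφ0 t)
  have hIφ : IntervalIntegrable (fun t => Real.log ‖φ t‖ * w t) volume (-R) R :=
    (hφl.mul hw).intervalIntegrable _ _
  rw [← intervalIntegral.integral_sub hI hIφ,
    ← intervalIntegral.integral_const_mul]
  have hbd : IntervalIntegrable (fun t => (2 + 4 * M) / c * W * ‖ψ t - φ t‖) volume (-R) R :=
    Continuous.intervalIntegrable (by fun_prop) _ _
  rw [← Real.norm_eq_abs]
  refine intervalIntegral.norm_integral_le_of_norm_le (by linarith)
    (Filter.Eventually.of_forall fun t ht => ?_) hbd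
  have htR : |t| ≤ R := abs_le.2 ⟨ht.1.le, ht.2⟩
  rw [← sub_mul, norm_mul]
  calc _ ≤ ((2 + 4 * M) * (|‖ψ t‖ - ‖φ t‖| / ‖φ t‖)) * W := by
        gcongr
        · exact abs_clamp_log_sub_log_le (norm_pos_iff.2 (hφ0 t)) (hφM t htR)
        · exact hwW t
    _ ≤ ((2 + 4 * M) * (‖ψ t - φ t‖ / c)) * W := by
        have : 0 ≤ W := (abs_nonneg _).trans (hwW 0)
        gcongr
        · exact abs_norm_sub_norm_le _ _
        · exact hφc t htR
    _ = _ := by ring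

/-- Mean squared error of a statistic whose error is controlled by the integrated error of the
empirical characteristic function. -/
theorem integral_sq_sub_le_of_abs_sub_le (P : Measure ℝ) [IsProbabilityMeasure P] {n : ℕ}
    (hn : 0 < n) {φ : ℝ → ℂ} (hφ : Continuous φ)
    (hφP : ∀ t : ℝ, ∫ x : ℝ, exp (I * t * x) ∂P = φ t)
    {X : (Fin n → ℝ) → ℝ} {s A B R : ℝ} (hR : 0 < R)
    (hX : ∀ z, |X z - s| ≤ B
      + A * ∫ t in (-R)..R, ‖(n : ℂ)⁻¹ * ∑ j, exp (I * t * z j) - φ t‖) :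
    ∫ z, (X z - s) ^ 2 ∂(Measure.pi fun _ : Fin n => P)
      ≤ 2 * B ^ 2 + 2 * A ^ 2 * (2 * R) ^ 2 * (n : ℝ)⁻¹ := by
  set F : ℝ → (Fin n → ℝ) → ℝ :=
    fun t z => ‖(n : ℂ)⁻¹ * ∑ j, exp (I * t * z j) - φ t‖ ^ 2 with hF
  have hn' : (n : ℝ) ≠ 0 := by positivity
  have hφ1 : ∀ t, ‖φ t‖ ≤ 1 := fun t => by
    rw [← hφP]
    refine (norm_integral_le_integral_norm _).trans ?_
    simp [norm_exp_I_mul_mul]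
  have hFint : Integrable (Function.uncurry F)
      ((volume.restrict (Set.uIoc (-R) R)).prod (Measure.pi fun _ : Fin n => P)) := by
    have : IsFiniteMeasure (volume.restrict (Set.uIoc (-R) R)) := ⟨by simp⟩
    refine Integrable.of_bound (Continuous.aestronglyMeasurable ?_) (2 ^ 2)
      (Filter.Eventually.of_forall fun x => ?_)
    · simp only [hF, Function.uncurry_def]
      fun_prop
    · simp only [hF, Function.uncurry_def, norm_pow, norm_norm]
      gcongr
      refine (norm_sub_le _ _).trans ?_
      have : ‖(n : ℂ)⁻¹ * ∑ j, exp (I * x.1 * x.2 j)‖ ≤ 1 := by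
        rw [norm_mul, norm_inv, norm_natCast]
        calc (n : ℝ)⁻¹ * ‖∑ j, exp (I * x.1 * x.2 j)‖
            ≤ (n : ℝ)⁻¹ * ∑ j, ‖exp (I * x.1 * x.2 j)‖ := by gcongr; exact norm_sum_le _ _
          _ = 1 := by simp [norm_exp_I_mul_mul, hn']
      linarith [hφ1 x.1]
  have hswap := intervalIntegral_integral_swap hFint
  have hRR : -R ≤ R := by linarith
  have hbound : ∫ t in (-R)..R, ∫ z, F t z ∂(Measure.pi fun _ : Fin n => P)
      ≤ 2 * R * (n : ℝ)⁻¹ := by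
    calc _ ≤ ∫ t in (-R)..R, (n : ℝ)⁻¹ := by
          refine intervalIntegral.integral_mono_on hRR ?_ (by simp) fun t _ => ?_
          · rw [intervalIntegrable_iff]
            exact hFint.integral_prod_left
          · have := integral_sq_empirical_charFun_sub_le P hn t
            rwa [hφP] at this
      _ = _ := by rw [intervalIntegral.integral_const, smul_eq_mul]; ring
  have hFz : Integrable (fun z => ∫ t in (-R)..R, F t z) (Measure.pi fun _ : Fin n => P) := by
    simp only [intervalIntegral.integral_of_le hRR]
    rw [Set.uIoc_of_le hRR] at hFint
    exact hFint.integral_prod_right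
  have hpt : ∀ z, (X z - s) ^ 2
      ≤ 2 * B ^ 2 + 2 * A ^ 2 * (2 * R) * ∫ t in (-R)..R, F t z := by
    intro z
    set J := ∫ t in (-R)..R, ‖(n : ℂ)⁻¹ * ∑ j, exp (I * t * z j) - φ t‖ with hJ
    have hJ2 : J ^ 2 ≤ (R - -R) * ∫ t in (-R)..R, F t z :=
      sq_intervalIntegral_le (by linarith) (by fun_prop)
    have h1 : (X z - s) ^ 2 ≤ (B + A * J) ^ 2 := by
      rw [← sq_abs]
      exact pow_le_pow_left₀ (abs_nonneg _) (hX z) 2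
    nlinarith [sq_nonneg (B - A * J), mul_le_mul_of_nonneg_left hJ2 (sq_nonneg A)]
  calc _ ≤ ∫ z, (2 * B ^ 2 + 2 * A ^ 2 * (2 * R) * ∫ t in (-R)..R, F t z)
        ∂(Measure.pi fun _ : Fin n => P) :=
        integral_mono_of_nonneg (Filter.Eventually.of_forall fun _ => sq_nonneg _)
          ((integrable_const _).add (hFz.const_mul _)) (Filter.Eventually.of_forall hpt)
    _ = 2 * B ^ 2 + 2 * A ^ 2 * (2 * R)
          * ∫ t in (-R)..R, ∫ z, F t z ∂(Measure.pi fun _ : Fin n => P) := by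
        rw [integral_add (integrable_const _) (hFz.const_mul _), integral_const_mul (2 * A ^ 2 * (2 * R)),
          ← hswap]
        simp
    _ ≤ 2 * B ^ 2 + 2 * A ^ 2 * (2 * R) * (2 * R * (n : ℝ)⁻¹) := by gcongr
    _ = _ := by ring

theorem eventually_pow_four_mul_exp_neg_le (β : ℝ) {κ : ℝ} (hκ : 0 < κ) :
    ∀ᶠ x : ℝ in Filter.atTop, x ^ 4 * Real.exp (-κ * x) ≤ x ^ (-β - 3) := by
  have h := (tendsto_rpow_mul_exp_neg_mul_atTop_nhds_zero (β + 7) κ hκ).eventually_le_const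
    zero_lt_one
  filter_upwards [h, Filter.eventually_gt_atTop 0] with x hx hx0
  have : x ^ 4 = x ^ (-β - 3) * x ^ (β + 7) := by
    rw [← Real.rpow_add hx0]
    ring_nf
    norm_cast
  rw [this, mul_assoc]
  exact mul_le_of_le_one_right (by positivity) hx

/-- With `x = log m`, the stochastic part of the risk is of smaller order than the squared bias. -/
theorem stochastic_error_le {β Sig Λ V η x M h m : ℝ} (hη : 0 < η) (hx : 1 ≤ x)
    (hM0 : 0 ≤ M) (hM : M ≤ 2 * η * x ^ 2) (hh : 0 < h) (hh2 : h ^ 2 = (η * x)⁻¹)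
    (hm : m = Real.exp x)
    (hasymp : x ^ 4 * Real.exp (-(1 - Sig ^ 2 * η) * x) ≤ x ^ (-β - 3)) :
    2 * ((2 + 4 * M) / Real.exp (-(Sig ^ 2 * (η * x) / 2 + 2 * Λ)) * (h ^ 3 * V)) ^ 2
        * (2 * (1 / h)) ^ 2 * m⁻¹
      ≤ 8 * (2 + 8 * η) ^ 2 * V ^ 2 * (η ^ 2)⁻¹ * Real.exp (4 * Λ) * x ^ (-β - 3) := by
  have hx0 : 0 < x := by linarith
  have hexp : (Real.exp (-(Sig ^ 2 * (η * x) / 2 + 2 * Λ)))⁻¹ ^ 2 * m⁻¹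
      = Real.exp (4 * Λ) * Real.exp (-(1 - Sig ^ 2 * η) * x) := by
    rw [hm, ← Real.exp_neg, ← Real.exp_neg, ← Real.exp_nat_mul, ← Real.exp_add, ← Real.exp_add]
    push_cast
    ring_nf
  have hh4 : h ^ 6 * (1 / h) ^ 2 = (η ^ 2)⁻¹ * (x ^ 2)⁻¹ := by
    rw [show h ^ 6 * (1 / h) ^ 2 = (h ^ 2) ^ 2 by field_simp, hh2]
    field_simp
  have hM2 : 2 + 4 * M ≤ (2 + 8 * η) * x ^ 2 := by nlinarith [one_le_pow₀ hx (n := 2)]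
  calc _ = 8 * (2 + 4 * M) ^ 2 * V ^ 2 * (h ^ 6 * (1 / h) ^ 2)
        * ((Real.exp (-(Sig ^ 2 * (η * x) / 2 + 2 * Λ)))⁻¹ ^ 2 * m⁻¹) := by
        rw [div_eq_mul_inv (2 + 4 * M)]; ring
    _ = 8 * (2 + 4 * M) ^ 2 * V ^ 2 * ((η ^ 2)⁻¹ * (x ^ 2)⁻¹)
        * (Real.exp (4 * Λ) * Real.exp (-(1 - Sig ^ 2 * η) * x)) := by rw [hexp, hh4]
    _ ≤ 8 * ((2 + 8 * η) * x ^ 2) ^ 2 * V ^ 2 * ((η ^ 2)⁻¹ * 1)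
        * (Real.exp (4 * Λ) * Real.exp (-(1 - Sig ^ 2 * η) * x)) := by
        gcongr
        exact inv_le_one_of_one_le₀ (one_le_pow₀ hx)
    _ = 8 * (2 + 8 * η) ^ 2 * V ^ 2 * (η ^ 2)⁻¹ * Real.exp (4 * Λ)
        * (x ^ 4 * Real.exp (-(1 - Sig ^ 2 * η) * x)) := by ring
    _ ≤ _ := by gcongr

/-- Uniform rate of convergence of the estimator `σ̂²` of the diffusion
coefficient over the class `𝒯` of Lévy triplets `(γ, σ², λf)` with `|γ| ≤ Γ`, `σ ∈ (0,Sig]`,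
`λ ∈ (0,Λ]`, `∫|t|^β|φ_f(t)|dt ≤ L`, `∫x¹²f(x)dx ≤ K` and `φ_f″` integrable:
`sup_𝒯 E[(σ̂² − σ²)²] ≤ C (log n)^{−β−3}` for all `n ≥ n₀`, where
`σ̂² = ∫_{−1/h}^{1/h} max{min{Mₙ, log|φ̂(t)|}, −Mₙ} h³v(ht) dt`,
`h = (η log n)^{−1/2}`, `Mₙ = (log log 3n)h^{−2}`, and the expectation is over an i.i.d.
sample `Z₁,…,Zₙ` with characteristic function `exp(iγt − σ²t²/2 + λ(φ_f(t)−1))`. -/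
theorem stmt4 (β L K Λ Sig Γ η : ℝ)
    (hβ : 0 < β) (hL : 0 < L) (hK : 0 < K) (hΛ : 0 < Λ) (hSig : 0 < Sig) (hΓ : 0 < Γ)
    (hη0 : 0 < η) (hη : η < 1 / (2 * Sig ^ 2))
    (v : ℝ → ℝ) (hv_cont : Continuous v)
    (hv_supp : Function.support v ⊆ Set.Icc (-1 : ℝ) 1)
    (hv_int0 : (∫ t in (-1 : ℝ)..1, v t) = 0)
    (hv_int2 : (∫ t in (-1 : ℝ)..1, (-(t ^ 2) / 2) * v t) = 1)
    (hv_O : v =O[nhds 0] fun t : ℝ => |t| ^ β) :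
    ∃ C : ℝ, 0 < C ∧ ∃ n₀ : ℕ, ∀ n : ℕ, n₀ ≤ n →
      ∀ (γ σ lam : ℝ) (f : ℝ → ℝ) (P : Measure ℝ) [IsProbabilityMeasure P],
        |γ| ≤ Γ → 0 < σ → σ ≤ Sig → 0 < lam → lam ≤ Λ →
        (∀ x : ℝ, 0 ≤ f x) → Integrable f → (∫ x : ℝ, f x) = 1 →
        Integrable (fun t : ℝ =>
          |t| ^ β * ‖∫ x : ℝ, Complex.exp (Complex.I * t * x) * f x‖) →
        (∫ t : ℝ, |t| ^ β * ‖∫ x : ℝ, Complex.exp (Complex.I * t * x) * f x‖) ≤ L →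
        Integrable (fun x : ℝ => x ^ 12 * f x) →
        (∫ x : ℝ, x ^ 12 * f x) ≤ K →
        Integrable (deriv (deriv
          (fun t : ℝ => ∫ x : ℝ, Complex.exp (Complex.I * t * x) * f x))) →
        (∀ t : ℝ, (∫ z : ℝ, Complex.exp (Complex.I * t * z) ∂P)
          = Complex.exp (Complex.I * γ * t - σ ^ 2 * t ^ 2 / 2
              + lam * ((∫ x : ℝ, Complex.exp (Complex.I * t * x) * f x) - 1))) →
        ∀ h Mn : ℝ, h = (η * Real.log n) ^ (-(1 / 2) : ℝ) →
          Mn = Real.log (Real.log (3 * n)) * h⁻¹ ^ 2 →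
          (∫ z : Fin n → ℝ,
              ((∫ t in (-(1 / h))..(1 / h),
                  max (min Mn
                      (Real.log ‖(n : ℂ)⁻¹ * ∑ j, Complex.exp (Complex.I * t * z j)‖))
                    (-Mn) * (h ^ 3 * v (h * t)))
                - σ ^ 2) ^ 2
            ∂(Measure.pi fun _ : Fin n => P))
          ≤ C * Real.log n ^ (-β - 3) := by
  obtain ⟨V, hV, hvV, hvβ⟩ := exists_abs_le_mul_rpow hβ hv_cont hv_supp hv_O
  have hκ : 0 < 1 - Sig ^ 2 * η := by
    rw [lt_div_iff₀ (by positivity)] at hη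
    nlinarith
  have hlog : Filter.Tendsto (fun n : ℕ => Real.log n) Filter.atTop Filter.atTop :=
    Real.tendsto_log_atTop.comp tendsto_natCast_atTop_atTop
  have hev : ∀ᶠ n : ℕ in Filter.atTop, _ := hlog.eventually
    ((eventually_pow_four_mul_exp_neg_le β hκ).and
      ((Filter.eventually_ge_atTop 1).and
        ((Filter.eventually_ge_atTop (Real.exp (Sig ^ 2 / 2 + 1))).and
          ((Filter.eventually_ge_atTop (2 * Λ / η)).and
            (Filter.eventually_ge_atTop (Real.log 3))))))
  obtain ⟨n₀, hn₀⟩ := Filter.eventually_atTop.1 hev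
  refine ⟨2 * (Λ ^ 2 * η ^ (-β - 3) * (V * L) ^ 2)
    + 8 * (2 + 8 * η) ^ 2 * V ^ 2 * (η ^ 2)⁻¹ * Real.exp (4 * Λ), by positivity, n₀, ?_⟩
  intro n hn γ σ lam f P _ _ hσ hσS hlam hlamΛ hf0 hf hf1 hfβ hfL _ _ _ hφP h Mn hh hMn
  obtain ⟨hasymp, hx1, hx2, hx3, hx4⟩ := hn₀ n hn
  set x := Real.log n with hx
  have hx0 : 0 < x := by linarith
  have hn0 : 0 < n := by
    rcases Nat.eq_zero_or_pos n with h0 | h0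
    · simp [hx, h0] at hx0
    · exact h0
  have hnx : (n : ℝ) = Real.exp x := (Real.exp_log (by positivity)).symm
  have hηx : 0 < η * x := by positivity
  have hhpos : 0 < h := hh ▸ Real.rpow_pos_of_pos hηx _
  have hh2 : h ^ 2 = (η * x)⁻¹ := by
    rw [hh, ← Real.rpow_natCast, ← Real.rpow_mul hηx.le, ← Real.rpow_neg_one]
    norm_num
  have hhinv : h⁻¹ ^ 2 = η * x := by rw [inv_pow, hh2, inv_inv]
  have hlog3 : Real.log (3 * n) = Real.log 3 + x := Real.log_mul (by norm_num) (by positivity)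
  have hlog3pos : 0 < Real.log 3 := Real.log_pos (by norm_num)
  have hll_lower : Sig ^ 2 / 2 + 1 ≤ Real.log (Real.log (3 * n)) := by
    rw [Real.le_log_iff_exp_le (by linarith)]
    linarith
  have hll_upper : Real.log (Real.log (3 * n)) ≤ 2 * x := by
    refine (Real.log_le_self (by linarith)).trans ?_
    linarith
  rw [hhinv] at hMn
  have hMlower : Sig ^ 2 * (η * x) / 2 + 2 * Λ ≤ Mn := by
    rw [div_le_iff₀ hη0] at hx3
    rw [hMn]
    nlinarith [mul_le_mul_of_nonneg_right hll_lower hηx.le]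
  have hMupper : Mn ≤ 2 * η * x ^ 2 := by
    rw [hMn]
    nlinarith [mul_le_mul_of_nonneg_right hll_upper hηx.le]
  have hM0 : 0 ≤ Mn := le_trans (by positivity) hMlower
  set φf : ℝ → ℂ := fun t => ∫ x : ℝ, exp (I * t * x) * f x with hφf
  have hφf_cont : Continuous φf := continuous_integral_exp_I_mul_mul hf
  have hφf_le : ∀ t, ‖φf t‖ ≤ 1 := fun t => hf1 ▸ norm_integral_exp_I_mul_mul_le hf0 t
  set φ : ℝ → ℂ := fun t => exp (I * γ * t - σ ^ 2 * t ^ 2 / 2 + lam * (φf t - 1)) with hφ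
  have hφ_cont : Continuous φ := by fun_prop
  have hlogφ : ∀ t, Real.log ‖φ t‖ = -(σ ^ 2 * t ^ 2 / 2) + lam * ((φf t).re - 1) := by
    intro t
    have : (I * γ * t - σ ^ 2 * t ^ 2 / 2 + lam * (φf t - 1) : ℂ)
        = ((-(σ ^ 2 * t ^ 2 / 2) - lam : ℝ) : ℂ) + ((γ * t : ℝ) : ℂ) * I + (lam : ℂ) * φf t := by
      push_cast; ring
    rw [hφ, norm_exp, Real.log_exp, this]
    simp only [add_re, ofReal_re, re_ofReal_mul, I_re]
    ring
  have hφ0 : ∀ t, φ t ≠ 0 := fun t => exp_ne_zero _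
  have hlogφ_le : ∀ t, |t| ≤ 1 / h → |Real.log ‖φ t‖| ≤ Sig ^ 2 * (η * x) / 2 + 2 * Λ := by
    intro t ht
    have hre := abs_le.1 ((abs_re_le_norm _).trans (hφf_le t))
    have ht2 : t ^ 2 ≤ η * x := by
      rw [← hhinv, ← sq_abs, ← one_div]
      gcongr
    have h1 : σ ^ 2 * t ^ 2 ≤ Sig ^ 2 * (η * x) := by gcongr
    have h2 : 0 ≤ σ ^ 2 * t ^ 2 := by positivity
    have h3 : lam * (1 - (φf t).re) ≤ Λ * 2 :=
      mul_le_mul hlamΛ (by linarith) (by linarith) hΛ.le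
    have h4 : 0 ≤ lam * (1 - (φf t).re) := mul_nonneg hlam.le (by linarith)
    rw [hlogφ, abs_le]
    constructor <;> linarith
  have hφ_lower : ∀ t, |t| ≤ 1 / h →
      Real.exp (-(Sig ^ 2 * (η * x) / 2 + 2 * Λ)) ≤ ‖φ t‖ := by
    intro t ht
    rw [← Real.le_log_iff_exp_le (norm_pos_iff.2 (hφ0 t))]
    exact (abs_le.1 (hlogφ_le t ht)).1
  have hbias := abs_integral_smoothed_log_sub_le (σ := σ) (r := fun t => (φf t).re) hlam.le hhpos
    hV.le hv_cont hv_int0 hv_int2 hvβ (by fun_prop) (fun t => abs_re_le_norm _) hfβ hfL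
  have hw : ∀ t, |h ^ 3 * v (h * t)| ≤ h ^ 3 * V := fun t => by
    rw [abs_mul, abs_of_pos (by positivity : 0 < h ^ 3)]
    gcongr
    exact hvV _
  have hX : ∀ z : Fin n → ℝ,
      |(∫ t in (-(1 / h))..(1 / h),
          max (min Mn (Real.log ‖(n : ℂ)⁻¹ * ∑ j, exp (I * t * z j)‖)) (-Mn)
            * (h ^ 3 * v (h * t))) - σ ^ 2|
        ≤ lam * (h ^ (3 + β) * (V * L))
          + (2 + 4 * Mn) / Real.exp (-(Sig ^ 2 * (η * x) / 2 + 2 * Λ)) * (h ^ 3 * V)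
            * ∫ t in (-(1 / h))..(1 / h), ‖(n : ℂ)⁻¹ * ∑ j, exp (I * t * z j) - φ t‖ := by
    intro z
    have hψ : Continuous fun t : ℝ => (n : ℂ)⁻¹ * ∑ j, exp (I * t * z j) := by fun_prop
    have hwc : Continuous fun t => h ^ 3 * v (h * t) := by fun_prop
    have hstoch := abs_integral_clamp_log_sub_le (by positivity : 0 ≤ 1 / h) (Real.exp_pos _)
      hφ_cont hψ hwc hw hφ_lower hφ0 (fun t ht => (hlogφ_le t ht).trans hMlower)
    simp only [hlogφ] at hstoch
    rw [add_comm]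
    exact (abs_sub_le _ _ _).trans (add_le_add hstoch hbias)
  refine (integral_sq_sub_le_of_abs_sub_le P hn0 hφ_cont hφP (by positivity) hX).trans ?_
  rw [add_mul]
  refine add_le_add ?_ (stochastic_error_le hη0 hx1 hM0 hMupper hhpos hh2 hnx hasymp)
  have hhβ : (h ^ (3 + β)) ^ 2 = η ^ (-β - 3) * x ^ (-β - 3) := by
    rw [← Real.mul_rpow hη0.le hx0.le, hh, ← Real.rpow_natCast, ← Real.rpow_mul hηx.le,
      ← Real.rpow_mul hηx.le]
    congr 1
    push_cast
    ring
  calc 2 * (lam * (h ^ (3 + β) * (V * L))) ^ 2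
      = 2 * (lam ^ 2 * (h ^ (3 + β)) ^ 2 * (V * L) ^ 2) := by ring
    _ ≤ 2 * (Λ ^ 2 * (h ^ (3 + β)) ^ 2 * (V * L) ^ 2) := by gcongr
    _ = _ := by rw [hhβ]; ring
end
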